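/- arXiv:math/0608492 — 2 statements merged into one kernel-verified Lean document; each statement's English description precedes it below -/
import Mathlib

section
/- Suppose X₁(0,0) ≠ 0. Let u be a first integral of X at (0,0) with u(0,0) = 0, and suppose the one-variable function x₂ ↦ u(0,x₂) vanishes to exact finite order k ≥ 1 at x₂ = 0 (i.e., u(0,x₂) = Σ_{i≥k} aᵢ x₂ⁱ with a_k ≠ 0). Then there exists a first integral ω of X at (0,0) with ω(0,0) = 0 and ∂₂ω(0,0) ≠ 0 such that ω(x₁,x₂)^k = u(x₁,x₂) for all (x₁,x₂) in a neighborhood of (0,0). -/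
open Filter MvPolynomial

/-- Evaluation of a polynomial in two variables at a point of `ℂ × ℂ`. -/
noncomputable def pev (P : MvPolynomial (Fin 2) ℂ) (p : ℂ × ℂ) : ℂ :=
  MvPolynomial.eval ![p.1, p.2] P

/-- Partial derivative with respect to the first variable. -/
noncomputable def d1 : (ℂ × ℂ → ℂ) → (ℂ × ℂ → ℂ) :=
  fun f p => deriv (fun x => f (x, p.2)) p.1

/-- Partial derivative with respect to the second variable. -/
noncomputable def d2 : (ℂ × ℂ → ℂ) → (ℂ × ℂ → ℂ) :=
  fun f p => deriv (fun y => f (p.1, y)) p.2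

/-- The differential operator `X(g) = X₁·∂₁g + X₂·∂₂g`. -/
noncomputable def Xop (X₁ X₂ : MvPolynomial (Fin 2) ℂ) (f : ℂ × ℂ → ℂ) : ℂ × ℂ → ℂ :=
  fun p => pev X₁ p * d1 f p + pev X₂ p * d2 f p

/-- A first integral of `X` at `p`: a nonconstant function, analytic near `p`,
annihilated by `X` near `p`. -/
def IsFirstIntegralAt (X₁ X₂ : MvPolynomial (Fin 2) ℂ) (ω : ℂ × ℂ → ℂ) (p : ℂ × ℂ) : Prop :=
  AnalyticAt ℂ ω p ∧ (∀ᶠ q in nhds p, Xop X₁ X₂ ω q = 0) ∧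
    ¬ ∃ c : ℂ, ∀ᶠ q in nhds p, ω q = c

/-- The functions `Bᵢ = −X₁·∂₂^{i+1}(X₂/X₁)`. -/
noncomputable def B (X₁ X₂ : MvPolynomial (Fin 2) ℂ) (i : ℕ) : ℂ × ℂ → ℂ :=
  fun p => -(pev X₁ p) * (d2^[i + 1] (fun q => pev X₂ q / pev X₁ q)) p

open scoped Topology

/-- The projection of `ℂ × ℂ` onto its first axis, as an endomorphism. -/
noncomputable def axisProj : ℂ × ℂ →L[ℂ] ℂ × ℂ :=
  (ContinuousLinearMap.inl ℂ ℂ ℂ).comp (ContinuousLinearMap.fst ℂ ℂ ℂ)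

theorem norm_axisProj_le : ‖axisProj‖ ≤ 1 :=
  ContinuousLinearMap.opNorm_le_bound _ zero_le_one fun z => by
    simp [axisProj, Prod.norm_def]

/-- The power series `q` such that `z.2 • q z = p z - p (z.1, 0)`. -/
noncomputable def divSndSeries (p : FormalMultilinearSeries ℂ (ℂ × ℂ) ℂ) :
    FormalMultilinearSeries ℂ (ℂ × ℂ) ℂ := fun n =>
  ∑ i : Fin (n + 1), (ContinuousMultilinearMap.curryMid i (p (n + 1)) ((0, 1) : ℂ × ℂ)
    : ContinuousMultilinearMap ℂ (fun _ : Fin n => ℂ × ℂ) ℂ).compContinuousLinearMap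
      fun j => if j.castSucc < i then ContinuousLinearMap.id ℂ (ℂ × ℂ) else axisProj

theorem norm_divSndSeries_le (p : FormalMultilinearSeries ℂ (ℂ × ℂ) ℂ) (n : ℕ) :
    ‖divSndSeries p n‖ ≤ (n + 1) * ‖p (n + 1)‖ := by
  have key : ∀ i ∈ (Finset.univ : Finset (Fin (n + 1))),
      ‖(ContinuousMultilinearMap.curryMid i (p (n + 1)) ((0, 1) : ℂ × ℂ)
        : ContinuousMultilinearMap ℂ (fun _ : Fin n => ℂ × ℂ) ℂ).compContinuousLinearMap
      fun j => if j.castSucc < i then ContinuousLinearMap.id ℂ (ℂ × ℂ) else axisProj‖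
        ≤ ‖p (n + 1)‖ := by
    intro i _
    refine (ContinuousMultilinearMap.norm_compContinuousLinearMap_le _ _).trans ?_
    have h1 : ‖(ContinuousMultilinearMap.curryMid i (p (n + 1)) ((0, 1) : ℂ × ℂ)
        : ContinuousMultilinearMap ℂ (fun _ : Fin n => ℂ × ℂ) ℂ)‖ ≤ ‖p (n + 1)‖ := by
      refine ContinuousMultilinearMap.opNorm_le_bound (norm_nonneg _) fun m => ?_
      have := (p (n + 1)).norm_map_insertNth_le (i := i) ((0, 1) : ℂ × ℂ) m
      simpa [Prod.norm_def] using this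
    have h2 : ∏ j : Fin n, ‖(if j.castSucc < i then ContinuousLinearMap.id ℂ (ℂ × ℂ)
        else axisProj)‖ ≤ 1 := by
      refine Finset.prod_le_one (fun _ _ => norm_nonneg _) fun j _ => ?_
      split_ifs
      · exact ContinuousLinearMap.norm_id_le
      · exact norm_axisProj_le
    calc _ ≤ ‖p (n + 1)‖ * 1 := mul_le_mul h1 h2 (by positivity) (norm_nonneg _)
      _ = _ := mul_one _
  refine (norm_sum_le_of_le _ key).trans ?_
  simp

theorem snd_mul_divSndSeries (p : FormalMultilinearSeries ℂ (ℂ × ℂ) ℂ) (n : ℕ) (z : ℂ × ℂ) :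
    z.2 * divSndSeries p n (fun _ => z) =
      p (n + 1) (fun _ => z) - p (n + 1) fun _ => axisProj z := by
  have h := (p (n + 1)).toMultilinearMap.map_sub_map_piecewise
    (fun _ => z) (fun _ => axisProj z) Finset.univ
  simp only [Finset.piecewise_univ, Finset.mem_univ, forall_const,
    ContinuousMultilinearMap.coe_coe] at h
  rw [h, divSndSeries, _root_.sum_apply, Finset.mul_sum]
  refine Finset.sum_congr rfl fun i _ => ?_
  have hz : z - axisProj z = z.2 • ((0, 1) : ℂ × ℂ) := by
    ext <;> simp [axisProj]
  rw [ContinuousMultilinearMap.compContinuousLinearMap_apply,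
    ContinuousMultilinearMap.curryMid_apply, ← smul_eq_mul]
  have h2 := (p (n + 1)).toMultilinearMap.map_update_smul
    (i.insertNth ((0, 1) : ℂ × ℂ) fun j : Fin n =>
      (if j.castSucc < i then ContinuousLinearMap.id ℂ (ℂ × ℂ) else axisProj) z) i z.2 (0, 1)
  simp only [ContinuousMultilinearMap.coe_coe, Fin.update_insertNth] at h2
  rw [← h2]
  congr 1
  funext j
  rcases Fin.eq_self_or_eq_succAbove i j with rfl | ⟨j, rfl⟩
  · simp [hz]
  · rw [Fin.insertNth_apply_succAbove, if_neg (Fin.succAbove_ne i j).symm]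
    simp only [Fin.succAbove_lt_iff_castSucc_lt]
    split_ifs <;> simp

theorem radius_divSndSeries_pos (p : FormalMultilinearSeries ℂ (ℂ × ℂ) ℂ) (hp : 0 < p.radius) :
    0 < (divSndSeries p).radius := by
  obtain ⟨C, r, hC, hr, h⟩ := p.le_mul_pow_of_radius_pos hp
  have hr' : 0 < (2 * r)⁻¹ := by positivity
  refine lt_of_lt_of_le ?_ ((divSndSeries p).le_radius_of_bound (C * r)
    (r := ⟨(2 * r)⁻¹, hr'.le⟩) fun n => ?_)
  · exact ENNReal.coe_pos.2 hr'
  · have hn : ((n : ℝ) + 1) ≤ 2 ^ n := by exact_mod_cast Nat.lt_two_pow_self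
    calc _ ≤ ((n + 1) * (C * r ^ (n + 1))) * ((2 * r)⁻¹) ^ n := by
          refine mul_le_mul_of_nonneg_right ?_ (by positivity)
          exact (norm_divSndSeries_le p n).trans (by gcongr; exact h _)
      _ ≤ (2 ^ n * (C * r ^ (n + 1))) * ((2 * r)⁻¹) ^ n := by gcongr
      _ = C * r := by
          rw [inv_pow, mul_pow, pow_succ]; field_simp

/-- An analytic function vanishing on the first axis is divisible by the second coordinate. -/
theorem AnalyticAt.exists_eq_snd_mul {v : ℂ × ℂ → ℂ} (hv : AnalyticAt ℂ v 0)
    (h0 : ∀ᶠ x in 𝓝 (0 : ℂ), v (x, 0) = 0) :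
    ∃ g : ℂ × ℂ → ℂ, AnalyticAt ℂ g 0 ∧ v =ᶠ[𝓝 0] fun z => z.2 * g z := by
  obtain ⟨p, hp⟩ := hv
  have hq := (divSndSeries p).hasFPowerSeriesOnBall
    (radius_divSndSeries_pos p hp.radius_pos) |>.hasFPowerSeriesAt
  refine ⟨_, hq.analyticAt, ?_⟩
  have hP : Tendsto axisProj (𝓝 0) (𝓝 0) := by
    simpa using axisProj.continuous.tendsto 0
  have hfst : Tendsto (Prod.fst : ℂ × ℂ → ℂ) (𝓝 0) (𝓝 0) := continuous_fst.tendsto (0 : ℂ × ℂ)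
  filter_upwards [hp.eventually_hasSum, hP.eventually hp.eventually_hasSum,
    hq.eventually_hasSum, hfst.eventually h0] with z h1 h2 h3 h4
  rw [zero_add] at h1 h2 h3
  have h5 : v (axisProj z) = 0 := by simpa [axisProj] using h4
  rw [h5] at h2
  have h6 := h1.sub h2
  rw [sub_zero, ← hasSum_nat_add_iff' 1] at h6
  have h7 : p 0 (fun _ => z) = p 0 (fun _ => axisProj z) :=
    congrArg _ (Subsingleton.elim _ _)
  simp only [Finset.sum_range_one, h7, sub_self, sub_zero, ← snd_mul_divSndSeries] at h6
  exact h6.unique (h3.mul_left z.2)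

theorem d2_eq_fderiv {f : ℂ × ℂ → ℂ} {p : ℂ × ℂ} (hf : DifferentiableAt ℂ f p) :
    d2 f p = fderiv ℂ f p (0, 1) := by
  have h : HasDerivAt (fun y : ℂ => (p.1, y)) ((0, 1) : ℂ × ℂ) p.2 :=
    (hasDerivAt_const _ _).prodMk (hasDerivAt_id _)
  exact (hf.hasFDerivAt.comp_hasDerivAt p.2 h).deriv

theorem d1_eq_fderiv {f : ℂ × ℂ → ℂ} {p : ℂ × ℂ} (hf : DifferentiableAt ℂ f p) :
    d1 f p = fderiv ℂ f p (1, 0) := by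
  have h : HasDerivAt (fun x : ℂ => (x, p.2)) ((1, 0) : ℂ × ℂ) p.1 :=
    (hasDerivAt_id _).prodMk (hasDerivAt_const _ _)
  exact (hf.hasFDerivAt.comp_hasDerivAt p.1 h).deriv

theorem AnalyticAt.d2_eventuallyEq {f : ℂ × ℂ → ℂ} {p : ℂ × ℂ} (hf : AnalyticAt ℂ f p) :
    d2 f =ᶠ[𝓝 p] fun q => fderiv ℂ f q (0, 1) := by
  filter_upwards [hf.eventually_analyticAt] with q hq
  exact d2_eq_fderiv hq.differentiableAt

theorem AnalyticAt.d1_eventuallyEq {f : ℂ × ℂ → ℂ} {p : ℂ × ℂ} (hf : AnalyticAt ℂ f p) :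
    d1 f =ᶠ[𝓝 p] fun q => fderiv ℂ f q (1, 0) := by
  filter_upwards [hf.eventually_analyticAt] with q hq
  exact d1_eq_fderiv hq.differentiableAt

theorem AnalyticAt.d2 {f : ℂ × ℂ → ℂ} {p : ℂ × ℂ} (hf : AnalyticAt ℂ f p) :
    AnalyticAt ℂ (d2 f) p :=
  ((ContinuousLinearMap.apply ℂ ℂ ((0, 1) : ℂ × ℂ)).analyticAt _ |>.comp hf.fderiv).congr
    hf.d2_eventuallyEq.symm

theorem AnalyticAt.d1 {f : ℂ × ℂ → ℂ} {p : ℂ × ℂ} (hf : AnalyticAt ℂ f p) :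
    AnalyticAt ℂ (d1 f) p :=
  ((ContinuousLinearMap.apply ℂ ℂ ((1, 0) : ℂ × ℂ)).analyticAt _ |>.comp hf.fderiv).congr
    hf.d1_eventuallyEq.symm

theorem AnalyticAt.iterate_d2 {f : ℂ × ℂ → ℂ} {p : ℂ × ℂ} (hf : AnalyticAt ℂ f p) (n : ℕ) :
    AnalyticAt ℂ (_root_.d2^[n] f) p := by
  induction n with
  | zero => exact hf
  | succ n ih => rw [Function.iterate_succ_apply']; exact ih.d2

theorem Filter.EventuallyEq.d2 {f g : ℂ × ℂ → ℂ} {p : ℂ × ℂ} (h : f =ᶠ[𝓝 p] g) :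
    d2 f =ᶠ[𝓝 p] d2 g := by
  filter_upwards [h.eventually_nhds] with q hq
  have hc : Tendsto (fun y : ℂ => (q.1, y)) (𝓝 q.2) (𝓝 q) :=
    (Continuous.prodMk_right q.1).tendsto q.2
  exact Filter.EventuallyEq.deriv_eq (hc.eventually hq)

theorem Filter.EventuallyEq.d1 {f g : ℂ × ℂ → ℂ} {p : ℂ × ℂ} (h : f =ᶠ[𝓝 p] g) :
    d1 f =ᶠ[𝓝 p] d1 g := by
  filter_upwards [h.eventually_nhds] with q hq
  have hc : Tendsto (fun x : ℂ => (x, q.2)) (𝓝 q.1) (𝓝 q) :=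
    (Continuous.prodMk_left q.2).tendsto q.1
  exact Filter.EventuallyEq.deriv_eq (hc.eventually hq)

theorem Filter.EventuallyEq.iterate_d2 {f g : ℂ × ℂ → ℂ} {p : ℂ × ℂ} (h : f =ᶠ[𝓝 p] g) (n : ℕ) :
    _root_.d2^[n] f =ᶠ[𝓝 p] _root_.d2^[n] g := by
  induction n with
  | zero => exact h
  | succ n ih => simp only [Function.iterate_succ_apply']; exact ih.d2

theorem d1_d2_comm {f : ℂ × ℂ → ℂ} {p : ℂ × ℂ} (hf : AnalyticAt ℂ f p) :
    d1 (d2 f) p = d2 (d1 f) p := by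
  have hd : HasFDerivAt (fderiv ℂ f) (fderiv ℂ (fderiv ℂ f) p) p :=
    hf.fderiv.differentiableAt.hasFDerivAt
  have h2 : ∀ v : ℂ × ℂ, HasFDerivAt (fun q => fderiv ℂ f q v)
      ((ContinuousLinearMap.apply ℂ ℂ v).comp (fderiv ℂ (fderiv ℂ f) p)) p := fun v =>
    (ContinuousLinearMap.apply ℂ ℂ v).hasFDerivAt.comp p hd
  rw [hf.d2_eventuallyEq.d1.eq_of_nhds, hf.d1_eventuallyEq.d2.eq_of_nhds,
    d1_eq_fderiv (h2 _).differentiableAt, d2_eq_fderiv (h2 _).differentiableAt,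
    (h2 _).fderiv, (h2 _).fderiv]
  exact hf.contDiffAt.isSymmSndFDerivAt_of_omega (1, 0) (0, 1)

theorem DifferentiableAt.slice_snd {f : ℂ × ℂ → ℂ} {p : ℂ × ℂ} (hf : DifferentiableAt ℂ f p) :
    DifferentiableAt ℂ (fun y => f (p.1, y)) p.2 :=
  DifferentiableAt.comp (g := f) p.2 hf (by fun_prop)

theorem d2_mul {f g : ℂ × ℂ → ℂ} {p : ℂ × ℂ} (hf : DifferentiableAt ℂ f p)
    (hg : DifferentiableAt ℂ g p) :
    d2 (fun q => f q * g q) p = d2 f p * g p + f p * d2 g p :=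
  deriv_fun_mul hf.slice_snd hg.slice_snd

theorem d2_sum {ι : Type*} {s : Finset ι} {f : ι → ℂ × ℂ → ℂ} {p : ℂ × ℂ}
    (hf : ∀ i ∈ s, DifferentiableAt ℂ (f i) p) :
    d2 (fun q => ∑ i ∈ s, f i q) p = ∑ i ∈ s, d2 (f i) p :=
  deriv_fun_sum fun i hi => (hf i hi).slice_snd

theorem iteratedDeriv_slice_eq_iterate_d2 (f : ℂ × ℂ → ℂ) (n : ℕ) (x y : ℂ) :
    iteratedDeriv n (fun y => f (x, y)) y = d2^[n] f (x, y) := by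
  induction n generalizing y with
  | zero => simp
  | succ n ih =>
    rw [iteratedDeriv_succ, Function.iterate_succ_apply', funext ih]
    rfl

/-- If `∂₁v = a ∂₂v`, then `∂₁∂₂ⁿv` is an analytic combination of `∂₂v, …, ∂₂ⁿ⁺¹v`. -/
theorem exists_d1_iterate_d2_eq_sum {v a : ℂ × ℂ → ℂ} {p : ℂ × ℂ} (hv : AnalyticAt ℂ v p)
    (ha : AnalyticAt ℂ a p) (h : d1 v =ᶠ[𝓝 p] fun q => a q * d2 v q) (n : ℕ) :
    ∃ c : ℕ → ℂ × ℂ → ℂ, (∀ j, AnalyticAt ℂ (c j) p) ∧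
      d1 (d2^[n] v) =ᶠ[𝓝 p] fun q => ∑ j ∈ Finset.range (n + 1), c j q * d2^[j + 1] v q := by
  induction n with
  | zero => exact ⟨fun _ => a, fun _ => ha, by simpa using h⟩
  | succ n ih =>
    obtain ⟨c, hc, hs⟩ := ih
    refine ⟨fun j q => (if j ≤ n then d2 (c j) q else 0) + if j = 0 then 0 else c (j - 1) q,
      fun j => ?_, ?_⟩
    · refine AnalyticAt.add ?_ ?_
      · split_ifs
        exacts [(hc j).d2, analyticAt_const]
      · split_ifs
        exacts [analyticAt_const, hc _]
    · have hcd : ∀ᶠ q in 𝓝 p, ∀ j ∈ Finset.range (n + 1), AnalyticAt ℂ (c j) q :=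
        (Filter.eventually_all_finset _).2 fun j _ => (hc j).eventually_analyticAt
      filter_upwards [hs.d2, hcd, hv.eventually_analyticAt] with q h1 h2 h3
      rw [Function.iterate_succ_apply', d1_d2_comm (h3.iterate_d2 n), h1,
        d2_sum (f := fun j q => c j q * d2^[j + 1] v q) fun j hj =>
        ((h2 j hj).mul (h3.iterate_d2 (j + 1))).differentiableAt]
      rw [Finset.sum_congr rfl fun j hj => d2_mul (h2 j hj).differentiableAt
        (h3.iterate_d2 (j + 1)).differentiableAt]
      simp only [add_mul, Finset.sum_add_distrib]
      congr 1
      · rw [Finset.sum_range_succ _ (n + 1)]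
        simp only [Nat.not_succ_le_self, if_false, zero_mul, add_zero]
        refine Finset.sum_congr rfl fun j hj => ?_
        rw [if_pos (Nat.lt_succ_iff.1 (Finset.mem_range.1 hj))]
      · rw [Finset.sum_range_succ' _ (n + 1)]
        simp [← Function.iterate_succ_apply' d2]

theorem AnalyticAt.slice_fst {f : ℂ × ℂ → ℂ} (hf : AnalyticAt ℂ f 0) :
    AnalyticAt ℂ (fun x => f (x, 0)) 0 :=
  AnalyticAt.comp (g := f) (f := fun x : ℂ => (x, (0 : ℂ))) hf (by fun_prop)

theorem tendsto_axis : Tendsto (fun x : ℂ => (x, (0 : ℂ))) (𝓝 0) (𝓝 0) :=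
  (Continuous.prodMk_left (0 : ℂ)).tendsto 0

theorem natCast_le_analyticOrderAt_sum {ι : Type*} {s : Finset ι} {f : ι → ℂ → ℂ} {z : ℂ} {n : ℕ}
    (hf : ∀ i ∈ s, AnalyticAt ℂ (f i) z) (h : ∀ i ∈ s, n ≤ analyticOrderAt (f i) z) :
    n ≤ analyticOrderAt (fun x => ∑ i ∈ s, f i x) z := by
  classical
  induction s using Finset.induction_on with
  | empty => simp [analyticOrderAt_eq_top.2]
  | insert i s hi ih =>
    simp only [Finset.sum_insert hi]
    exact (le_min (h i (by simp)) (ih (fun j hj => hf j (by simp [hj]))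
      fun j hj => h j (by simp [hj]))).trans le_analyticOrderAt_add

/-- If `∂₁v = a ∂₂v`, `∂₂ᵐv` vanishes along the first axis and the lower `∂₂ⁱv` vanish at the origin,
then they all vanish along the first axis. -/
theorem eventually_iterate_d2_axis_eq_zero {v a : ℂ × ℂ → ℂ} (hv : AnalyticAt ℂ v 0)
    (ha : AnalyticAt ℂ a 0) (h : d1 v =ᶠ[𝓝 0] fun q => a q * d2 v q) {m : ℕ}
    (h0 : ∀ i < m, d2^[i] v 0 = 0) (hm : ∀ᶠ x in 𝓝 (0 : ℂ), d2^[m] v (x, 0) = 0) :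
    ∀ i ≤ m, ∀ᶠ x in 𝓝 (0 : ℂ), d2^[i] v (x, 0) = 0 := by
  have key : ∀ n : ℕ, ∀ i ≤ m, n ≤ analyticOrderAt (fun x => d2^[i] v (x, 0)) 0 := by
    intro n
    induction n with
    | zero => simp
    | succ n ih =>
      intro i hi
      rcases hi.eq_or_lt with rfl | hi
      · rw [analyticOrderAt_eq_top.2 hm]; exact le_top
      rw [Nat.cast_add_one, ← analyticOrderAt_deriv_ge_iff (hv.iterate_d2 i).slice_fst (h0 i hi)]
      obtain ⟨c, hc, hs⟩ := exists_d1_iterate_d2_eq_sum hv ha h i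
      have hd : deriv (fun x => d2^[i] v (x, 0)) =ᶠ[𝓝 0]
          fun x => ∑ j ∈ Finset.range (i + 1), c j (x, 0) * d2^[j + 1] v (x, 0) :=
        tendsto_axis.eventually hs
      rw [analyticOrderAt_congr hd]
      refine natCast_le_analyticOrderAt_sum
        (fun j _ => (hc j).slice_fst.mul (hv.iterate_d2 (j + 1)).slice_fst) fun j hj => ?_
      have hj' := ih (j + 1) (by have := Finset.mem_range.1 hj; omega)
      refine hj'.trans ?_
      have := analyticOrderAt_mul (hc j).slice_fst (hv.iterate_d2 (j + 1)).slice_fst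
      exact le_add_self.trans_eq this.symm
  exact fun i hi => analyticOrderAt_eq_top.1 (ENat.eq_top_iff_forall_ge.2 fun n => key n i hi)

theorem iterate_d2_snd_mul {g : ℂ × ℂ → ℂ} {p : ℂ × ℂ} (hg : AnalyticAt ℂ g p) (n : ℕ) :
    d2^[n + 1] (fun q => q.2 * g q) =ᶠ[𝓝 p]
      fun q => (n + 1) * d2^[n] g q + q.2 * d2^[n + 1] g q := by
  have step : ∀ f : ℂ × ℂ → ℂ, ∀ q, AnalyticAt ℂ f q →
      d2 (fun q => q.2 * f q) q = f q + q.2 * d2 f q := fun f q hf => by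
    rw [d2_mul differentiableAt_snd hf.differentiableAt]
    simp [d2]
  induction n with
  | zero =>
    filter_upwards [hg.eventually_analyticAt] with q hq
    simpa using step g q hq
  | succ n ih =>
    rw [Function.iterate_succ_apply']
    filter_upwards [ih.d2, hg.eventually_analyticAt] with q h1 h2
    have h3 := (h2.iterate_d2 n).differentiableAt
    have h4 := (h2.iterate_d2 (n + 1))
    have h5 : d2 (fun q => (n + 1 : ℂ) * d2^[n] g q + q.2 * d2^[n + 1] g q) q =
        d2 (fun q => (n + 1 : ℂ) * d2^[n] g q) q + d2 (fun q => q.2 * d2^[n + 1] g q) q :=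
      deriv_fun_add (h3.const_mul _).slice_snd
        (differentiableAt_snd.mul h4.differentiableAt).slice_snd
    have h6 : d2 (fun q => (n + 1 : ℂ) * d2^[n] g q) q = (n + 1) * d2 (d2^[n] g) q :=
      deriv_const_mul _ h3.slice_snd
    rw [h1, h5, h6, step _ q h4, Function.iterate_succ_apply' d2 (n + 1),
      Function.iterate_succ_apply' d2 n]
    push_cast
    ring

/-- An analytic function whose first `k` derivatives in `x₂` vanish along the first axis is divisible by
`x₂ ^ k`. -/
theorem exists_eq_snd_pow_mul (k : ℕ) {v : ℂ × ℂ → ℂ} (hv : AnalyticAt ℂ v 0)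
    (h : ∀ i < k, ∀ᶠ x in 𝓝 (0 : ℂ), d2^[i] v (x, 0) = 0) :
    ∃ g : ℂ × ℂ → ℂ, AnalyticAt ℂ g 0 ∧ (v =ᶠ[𝓝 0] fun z => z.2 ^ k * g z) ∧
      d2^[k] v 0 = k.factorial * g 0 := by
  induction k generalizing v with
  | zero => exact ⟨v, hv, by simp, by simp⟩
  | succ k ih =>
    obtain ⟨w, hw, hvw⟩ := hv.exists_eq_snd_mul (h 0 k.succ_pos)
    have hd : ∀ n, d2^[n + 1] v =ᶠ[𝓝 0] fun q => (n + 1) * d2^[n] w q + q.2 * d2^[n + 1] w q :=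
      fun n => (hvw.iterate_d2 (n + 1)).trans (iterate_d2_snd_mul hw n)
    obtain ⟨g, hg, hwg, hg0⟩ := ih hw fun i hi => by
      filter_upwards [tendsto_axis.eventually (hd i), h (i + 1) (by omega)] with x h1 h2
      rw [h2] at h1
      have hi1 : (i + 1 : ℂ) ≠ 0 := i.cast_add_one_ne_zero
      simpa [hi1] using h1.symm
    refine ⟨g, hg, ?_, ?_⟩
    · filter_upwards [hvw, hwg] with z h1 h2
      rw [h1, h2]; ring
    · rw [(hd k).eq_of_nhds, hg0, Nat.factorial_succ]
      push_cast
      simp [mul_assoc]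

/-- A nonvanishing analytic germ has an analytic `k`-th root. -/
theorem AnalyticAt.exists_pow_eq {E : Type*} [NormedAddCommGroup E] [NormedSpace ℂ E] {g : E → ℂ}
    {p : E} (hg : AnalyticAt ℂ g p) (hp : g p ≠ 0) {k : ℕ} (hk : k ≠ 0) :
    ∃ r : E → ℂ, AnalyticAt ℂ r p ∧ ∀ᶠ z in 𝓝 p, r z ^ k = g z := by
  obtain ⟨c, hc⟩ := IsAlgClosed.exists_pow_nat_eq (g p) (Nat.pos_of_ne_zero hk)
  have hdiv : AnalyticAt ℂ (fun z => g z / g p) p := hg.div analyticAt_const hp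
  refine ⟨fun z => c * Complex.exp (Complex.log (g z / g p) / k), ?_, ?_⟩
  · refine analyticAt_const.mul (AnalyticAt.cexp ((hdiv.clog ?_).div analyticAt_const ?_))
    · simp [hp]
    · exact_mod_cast hk
  · filter_upwards [hg.continuousAt.eventually_ne hp] with z hz
    rw [mul_pow, hc, ← Complex.exp_nat_mul, mul_div_cancel₀ _ (Nat.cast_ne_zero.2 hk),
      Complex.exp_log (div_ne_zero hz hp), mul_div_cancel₀ _ hp]

theorem analyticAt_pev (P : MvPolynomial (Fin 2) ℂ) (p : ℂ × ℂ) : AnalyticAt ℂ (pev P) p := by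
  have h := AnalyticAt.aeval_mvPolynomial (𝕜 := ℂ) (z := p)
    (f := fun (q : ℂ × ℂ) (i : Fin 2) => (![q.1, q.2] : Fin 2 → ℂ) i)
    (fun i => by fin_cases i <;> [exact analyticAt_fst; exact analyticAt_snd]) P
  exact h.congr (Eventually.of_forall fun q => by simp [pev, MvPolynomial.aeval_eq_eval])

theorem AnalyticAt.Xop {f : ℂ × ℂ → ℂ} {p : ℂ × ℂ} (hf : AnalyticAt ℂ f p)
    (X₁ X₂ : MvPolynomial (Fin 2) ℂ) : AnalyticAt ℂ (Xop X₁ X₂ f) p :=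
  ((analyticAt_pev X₁ p).mul hf.d1).add ((analyticAt_pev X₂ p).mul hf.d2)

theorem AnalyticAt.exists_implicit_axis {w : ℂ × ℂ → ℂ} (hw : AnalyticAt ℂ w 0) (h0 : w 0 = 0)
    (h : _root_.d2 w 0 ≠ 0) :
    ∃ φ : ℂ → ℂ, AnalyticAt ℂ φ 0 ∧ φ 0 = 0 ∧ ∀ᶠ x in 𝓝 (0 : ℂ), w (x, φ x) = 0 := by
  have hc : ContDiffAt ℂ ⊤ w 0 := hw.contDiffAt
  have hi : (fderiv ℂ w 0 ∘L .inr ℂ ℂ ℂ).IsInvertible := by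
    refine ⟨ContinuousLinearEquiv.unitsEquivAut ℂ (Units.mk0 _ h), ?_⟩
    ext
    simp [d2_eq_fderiv hw.differentiableAt]
  refine ⟨hc.implicitFunction (by simp) hi, ?_, ?_, ?_⟩
  · exact (hc.contDiffAt_implicitFunction (by simp) hi).analyticAt
  · exact hc.implicitFunction_apply_self (by simp) hi
  · have := hc.eventually_apply_implicitFunction (by simp) hi
    rwa [h0] at this

theorem iterate_d2_shear (u : ℂ × ℂ → ℂ) (φ : ℂ → ℂ) (n : ℕ) :
    d2^[n] (fun q => u (q.1, q.2 + φ q.1)) = fun q => d2^[n] u (q.1, q.2 + φ q.1) := by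
  induction n with
  | zero => rfl
  | succ n ih =>
    rw [Function.iterate_succ_apply', ih, Function.iterate_succ_apply']
    funext q
    exact deriv_comp_add_const (fun y => d2^[n] u (q.1, y)) (φ q.1) q.2

theorem d1_shear {u : ℂ × ℂ → ℂ} {φ : ℂ → ℂ} {q : ℂ × ℂ}
    (hu : DifferentiableAt ℂ u (q.1, q.2 + φ q.1)) (hφ : DifferentiableAt ℂ φ q.1) :
    d1 (fun q => u (q.1, q.2 + φ q.1)) q =
      d1 u (q.1, q.2 + φ q.1) + deriv φ q.1 * d2 u (q.1, q.2 + φ q.1) := by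
  have hc : HasDerivAt (fun x => (x, q.2 + φ x)) (1, deriv φ q.1) q.1 :=
    (hasDerivAt_id _).prodMk (hφ.hasDerivAt.const_add _)
  have h := (hu.hasFDerivAt.comp_hasDerivAt q.1 hc).deriv
  have hv : ((1, deriv φ q.1) : ℂ × ℂ) = (1, 0) + deriv φ q.1 • (0, 1) := by simp
  rw [hv, map_add, map_smul, ← d1_eq_fderiv hu, ← d2_eq_fderiv hu] at h
  exact h

/-- A shear `(x, y) ↦ (x, y + φ x)` turns `X₁ ∂₁u + X₂ ∂₂u = 0` with `X₁ ≠ 0` into an equation of the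
form `∂₁v = a ∂₂v`. -/
theorem exists_d1_shear_eq_mul_d2 {X₁ X₂ : MvPolynomial (Fin 2) ℂ} (hX₁ : pev X₁ 0 ≠ 0)
    {u : ℂ × ℂ → ℂ} (hu : AnalyticAt ℂ u 0) (hX : ∀ᶠ q in 𝓝 0, Xop X₁ X₂ u q = 0) {φ : ℂ → ℂ}
    (hφ : AnalyticAt ℂ φ 0) (hφ0 : φ 0 = 0) :
    ∃ a : ℂ × ℂ → ℂ, AnalyticAt ℂ a 0 ∧ d1 (fun q => u (q.1, q.2 + φ q.1)) =ᶠ[𝓝 0]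
      fun q => a q * d2 (fun q => u (q.1, q.2 + φ q.1)) q := by
  have hφ1 : AnalyticAt ℂ (fun q : ℂ × ℂ => φ q.1) 0 :=
    AnalyticAt.comp (g := φ) (f := Prod.fst) hφ analyticAt_fst
  have hφ2 : AnalyticAt ℂ (fun q : ℂ × ℂ => deriv φ q.1) 0 :=
    AnalyticAt.comp (g := deriv φ) (f := Prod.fst) hφ.deriv analyticAt_fst
  have hs : AnalyticAt ℂ (fun q : ℂ × ℂ => (q.1, q.2 + φ q.1)) 0 :=
    analyticAt_fst.prod (analyticAt_snd.add hφ1)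
  have hs0 : ((0 : ℂ × ℂ).1, (0 : ℂ × ℂ).2 + φ (0 : ℂ × ℂ).1) = 0 := by simp [hφ0]
  have hst : Tendsto (fun q : ℂ × ℂ => (q.1, q.2 + φ q.1)) (𝓝 0) (𝓝 0) := by
    simpa [ContinuousAt, hφ0, Prod.mk_zero_zero] using hs.continuousAt
  have hP : ∀ P : MvPolynomial (Fin 2) ℂ,
      AnalyticAt ℂ (fun q : ℂ × ℂ => pev P (q.1, q.2 + φ q.1)) 0 :=
    fun P => (analyticAt_pev P _).comp hs
  refine ⟨fun q => deriv φ q.1 - pev X₂ (q.1, q.2 + φ q.1) / pev X₁ (q.1, q.2 + φ q.1),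
    hφ2.sub ((hP X₂).div (hP X₁) (by rwa [hs0])), ?_⟩
  have hfst : Tendsto (Prod.fst : ℂ × ℂ → ℂ) (𝓝 0) (𝓝 0) := continuous_fst.tendsto (0 : ℂ × ℂ)
  filter_upwards [hst.eventually hu.eventually_analyticAt, hst.eventually hX,
    hst.eventually ((analyticAt_pev X₁ 0).continuousAt.eventually_ne hX₁),
    hfst.eventually hφ.eventually_analyticAt] with q h1 h2 h3 h4
  have h5 := congrFun (iterate_d2_shear u φ 1) q
  simp only [Function.iterate_one] at h5
  rw [d1_shear h1.differentiableAt h4.differentiableAt, h5]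
  simp only [_root_.Xop] at h2
  field_simp
  linear_combination h2

/-- A root of a first integral is annihilated by `X` where it is a submersion along `x₂`. -/
theorem eventually_Xop_eq_zero_of_pow_eq {X₁ X₂ : MvPolynomial (Fin 2) ℂ} {u ω : ℂ × ℂ → ℂ}
    {p : ℂ × ℂ} {k : ℕ} (hk : k ≠ 0) (hω : AnalyticAt ℂ ω p) (hd : d2 ω p ≠ 0)
    (hX : ∀ᶠ q in 𝓝 p, Xop X₁ X₂ u q = 0) (hpow : ∀ᶠ q in 𝓝 p, ω q ^ k = u q) :
    ∀ᶠ q in 𝓝 p, Xop X₁ X₂ ω q = 0 := by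
  have hmul : ∀ᶠ q in 𝓝 p, ω q ≠ 0 → Xop X₁ X₂ ω q = 0 := by
    have hpow' : (fun q => ω q ^ k) =ᶠ[𝓝 p] u := hpow
    filter_upwards [hX, hpow'.d1, hpow'.d2, hω.eventually_analyticAt] with q h1 h2 h3 h4 h5
    have e2 : d2 (fun q => ω q ^ k) q = k * ω q ^ (k - 1) * d2 ω q :=
      deriv_fun_pow h4.differentiableAt.slice_snd k
    have e1 : d1 (fun q => ω q ^ k) q = k * ω q ^ (k - 1) * d1 ω q :=
      deriv_fun_pow (DifferentiableAt.comp (g := ω) (f := fun x => (x, q.2)) q.1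
        h4.differentiableAt (by fun_prop)) k
    simp only [Xop, ← h2, ← h3, e1, e2] at h1 ⊢
    have h6 : (k : ℂ) * ω q ^ (k - 1) ≠ 0 :=
      mul_ne_zero (Nat.cast_ne_zero.2 hk) (pow_ne_zero _ h5)
    refine (mul_eq_zero.1 (?_ : k * ω q ^ (k - 1) * _ = 0)).resolve_left h6
    linear_combination h1
  filter_upwards [hmul.eventually_nhds, hω.eventually_analyticAt,
    hω.d2.continuousAt.eventually_ne hd] with q h1 h2 h3
  have hc : ContinuousAt (fun y : ℂ => (q.1, y)) q.2 := (Continuous.prodMk_right q.1).continuousAt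
  have h4 : ∀ᶠ y in 𝓝[≠] q.2, ω (q.1, y) ≠ 0 :=
    h2.differentiableAt.slice_snd.hasDerivAt.eventually_ne h3
  have h5 : ∀ᶠ y in 𝓝[≠] q.2, Xop X₁ X₂ ω (q.1, y) = 0 := by
    filter_upwards [h4, (hc.eventually h1).filter_mono nhdsWithin_le_nhds] with y h6 h7
    exact h7 h6
  have h6 : ContinuousAt (fun y => Xop X₁ X₂ ω (q.1, y)) q.2 :=
    ContinuousAt.comp (g := Xop X₁ X₂ ω) (h2.Xop X₁ X₂).continuousAt hc
  exact tendsto_nhds_unique_of_eventuallyEq (h6.tendsto.mono_left nhdsWithin_le_nhds)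
    tendsto_const_nhds h5

/-- from a first integral `u` vanishing to exact order `k ≥ 1` along `x₁ = 0`,
one gets a first integral `ω` with `ω(0,0) = 0`, `∂₂ω(0,0) ≠ 0` and `ω^k = u` near `(0,0)`. -/
theorem stmt_1 (X₁ X₂ : MvPolynomial (Fin 2) ℂ)
    (hX₁ : pev X₁ ((0 : ℂ), (0 : ℂ)) ≠ 0) (u : ℂ × ℂ → ℂ)
    (hu : IsFirstIntegralAt X₁ X₂ u ((0 : ℂ), (0 : ℂ)))
    (hu0 : u ((0 : ℂ), (0 : ℂ)) = 0)
    (k : ℕ) (hk : 1 ≤ k)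
    (hlow : ∀ i < k, iteratedDeriv i (fun y => u (0, y)) 0 = 0)
    (hhigh : iteratedDeriv k (fun y => u (0, y)) 0 ≠ 0) :
    ∃ ω : ℂ × ℂ → ℂ, IsFirstIntegralAt X₁ X₂ ω ((0 : ℂ), (0 : ℂ)) ∧
      ω ((0 : ℂ), (0 : ℂ)) = 0 ∧ d2 ω ((0 : ℂ), (0 : ℂ)) ≠ 0 ∧
      ∀ᶠ q in nhds ((0 : ℂ), (0 : ℂ)), ω q ^ k = u q := by
  rw [Prod.mk_zero_zero] at *
  obtain ⟨hua, huX, -⟩ := hu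
  obtain ⟨m, rfl⟩ : ∃ m, k = m + 1 := ⟨k - 1, by omega⟩
  simp only [iteratedDeriv_slice_eq_iterate_d2, Prod.mk_zero_zero] at hlow hhigh
  obtain ⟨φ, hφ, hφ0, hm⟩ := (hua.iterate_d2 m).exists_implicit_axis (hlow m m.lt_succ_self)
    (by rwa [Function.iterate_succ_apply'] at hhigh)
  obtain ⟨a, ha, hav⟩ := exists_d1_shear_eq_mul_d2 hX₁ hua huX hφ hφ0
  have hφ1 : AnalyticAt ℂ (fun q : ℂ × ℂ => φ q.1) 0 :=
    AnalyticAt.comp (g := φ) (f := Prod.fst) hφ analyticAt_fst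
  have hv : AnalyticAt ℂ (fun q : ℂ × ℂ => u (q.1, q.2 + φ q.1)) 0 :=
    AnalyticAt.fun_comp (g := u) (by simpa [hφ0, Prod.mk_zero_zero] using hua)
      (analyticAt_fst.prod (analyticAt_snd.add hφ1))
  have hzero := eventually_iterate_d2_axis_eq_zero hv ha hav (m := m)
    (fun i hi => by simpa [iterate_d2_shear, hφ0, Prod.mk_zero_zero] using hlow i (by omega))
    (by simpa [iterate_d2_shear] using hm)
  obtain ⟨g, hg, hvg, hg0⟩ := exists_eq_snd_pow_mul (m + 1) hv
    fun i hi => hzero i (Nat.lt_succ_iff.1 hi)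
  have hgne : g 0 ≠ 0 := by
    rintro h
    simp [h, iterate_d2_shear, hφ0, Prod.mk_zero_zero] at hg0
    exact hhigh hg0
  obtain ⟨r, hr, hrg⟩ := hg.exists_pow_eq hgne m.succ_ne_zero
  have hr0 : r 0 ≠ 0 := fun h => hgne (by simpa [h] using hrg.self_of_nhds.symm)
  have hs : AnalyticAt ℂ (fun q : ℂ × ℂ => (q.1, q.2 - φ q.1)) 0 :=
    analyticAt_fst.prod (analyticAt_snd.sub hφ1)
  have hst : Tendsto (fun q : ℂ × ℂ => (q.1, q.2 - φ q.1)) (𝓝 0) (𝓝 0) := by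
    simpa [ContinuousAt, hφ0, Prod.mk_zero_zero] using hs.continuousAt
  have hrs : AnalyticAt ℂ (fun q : ℂ × ℂ => r (q.1, q.2 - φ q.1)) 0 :=
    AnalyticAt.fun_comp (g := r) (by simpa [hφ0, Prod.mk_zero_zero] using hr) hs
  have hω : AnalyticAt ℂ (fun q : ℂ × ℂ => (q.2 - φ q.1) * r (q.1, q.2 - φ q.1)) 0 :=
    (analyticAt_snd.sub hφ1).mul hrs
  have hd : d2 (fun q : ℂ × ℂ => (q.2 - φ q.1) * r (q.1, q.2 - φ q.1)) 0 ≠ 0 := by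
    rw [d2_mul (f := fun q => q.2 - φ q.1) (analyticAt_snd.sub hφ1).differentiableAt hrs.differentiableAt]
    simpa [d2, hφ0, Prod.mk_zero_zero] using hr0
  have hpow : ∀ᶠ q in 𝓝 (0 : ℂ × ℂ),
      ((q.2 - φ q.1) * r (q.1, q.2 - φ q.1)) ^ (m + 1) = u q := by
    filter_upwards [hst.eventually hvg, hst.eventually hrg] with q h1 h2
    rw [mul_pow, h2, ← h1]
    simp
  refine ⟨_, ⟨hω, eventually_Xop_eq_zero_of_pow_eq m.succ_ne_zero hω hd huX hpow, ?_⟩, ?_, hd, hpow⟩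
  · rintro ⟨c, hc⟩
    have hc' : _ =ᶠ[𝓝 (0 : ℂ × ℂ)] fun _ => c := hc
    exact hd (by rw [hc'.d2.eq_of_nhds]; simp [d2])
  · simp [hφ0, Prod.mk_zero_zero]
end

section
/- Suppose X₁(0,0) ≠ 0 and let ω ∈ Ω¹. Let α₁, …, α_n be rational functions in x₁,x₂, each defined (pole-free) in a neighborhood of (0,0), and let f₁, …, f_n ∈ 𝒜₀. Suppose the function of three variables (x₁,x₂,y) ↦ Σ_{k=1}^n α_k(x₁,x₂)·f_k(y) is not identically zero on any neighborhood of (0,0,0), but Σ_{k=1}^n α_k(x₁,x₂)·f_k(ω(x₁,x₂)) = 0 for all (x₁,x₂) in a neighborhood of (0,0). Then there exists a nonconstant rational function w in x₁,x₂ with X₁·∂₁w + X₂·∂₂w = 0 (as rational functions). -/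
open Filter MvPolynomial

open Topology

/-- The derivation `X = X₁·∂₁ + X₂·∂₂` of the polynomial ring. -/
noncomputable def polyX (X₁ X₂ A : MvPolynomial (Fin 2) ℂ) : MvPolynomial (Fin 2) ℂ :=
  X₁ * pderiv (0 : Fin 2) A + X₂ * pderiv (1 : Fin 2) A

theorem hasDerivAt_pev_fst (A : MvPolynomial (Fin 2) ℂ) (a b : ℂ) :
    HasDerivAt (fun x => pev A (x, b)) (pev (pderiv (0 : Fin 2) A) (a, b)) a := by
  induction A using MvPolynomial.induction_on with
  | C c => simpa [pev] using hasDerivAt_const a c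
  | add p q hp hq => simpa [pev] using hp.fun_add hq
  | mul_X p i hp =>
    fin_cases i
    · simpa [pev, pderiv_X, add_comm, mul_comm] using hp.fun_mul (hasDerivAt_id' a)
    · simpa [pev, pderiv_X, add_comm, mul_comm] using hp.fun_mul (hasDerivAt_const a b)

theorem hasDerivAt_pev_snd (A : MvPolynomial (Fin 2) ℂ) (a b : ℂ) :
    HasDerivAt (fun y => pev A (a, y)) (pev (pderiv (1 : Fin 2) A) (a, b)) b := by
  induction A using MvPolynomial.induction_on with
  | C c => simpa [pev] using hasDerivAt_const b c
  | add p q hp hq => simpa [pev] using hp.fun_add hq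
  | mul_X p i hp =>
    fin_cases i
    · simpa [pev, pderiv_X, add_comm, mul_comm] using hp.fun_mul (hasDerivAt_const b a)
    · simpa [pev, pderiv_X, add_comm, mul_comm] using hp.fun_mul (hasDerivAt_id' b)

theorem continuous_pev (A : MvPolynomial (Fin 2) ℂ) : Continuous (pev A) := by
  have h : Continuous fun p : ℂ × ℂ => (![p.1, p.2] : Fin 2 → ℂ) := by fun_prop
  exact (MvPolynomial.continuous_eval A).comp h

theorem eq_zero_of_eventually_pev_eq_zero (A : MvPolynomial (Fin 2) ℂ) (p : ℂ × ℂ)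
    (h : ∀ᶠ q in 𝓝 p, pev A q = 0) : A = 0 := by
  obtain ⟨a, b⟩ := p
  rw [nhds_prod_eq, eventually_prod_iff] at h
  obtain ⟨s, hs, t, ht, hst⟩ := h
  refine MvPolynomial.funext_set ![{x | s x}, {y | t y}] (fun i => ?_) (fun v hv => ?_)
  · fin_cases i
    · exact infinite_of_mem_nhds a hs
    · exact infinite_of_mem_nhds b ht
  · have h0 := hst (hv 0 trivial) (hv 1 trivial)
    have e : (![v 0, v 1] : Fin 2 → ℂ) = v := by
      ext i; fin_cases i <;> rfl
    simpa [pev, e] using h0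

theorem hasDerivAt_slice_fst {ω : ℂ × ℂ → ℂ} {q : ℂ × ℂ} (h : DifferentiableAt ℂ ω q) :
    HasDerivAt (fun x => ω (x, q.2)) (d1 ω q) q.1 := by
  have : DifferentiableAt ℂ (fun x => ω (x, q.2)) q.1 :=
    DifferentiableAt.comp q.1 (f := fun x => (x, q.2)) (g := ω) h (by fun_prop)
  exact this.hasDerivAt

theorem hasDerivAt_slice_snd {ω : ℂ × ℂ → ℂ} {q : ℂ × ℂ} (h : DifferentiableAt ℂ ω q) :
    HasDerivAt (fun y => ω (q.1, y)) (d2 ω q) q.2 := by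
  have : DifferentiableAt ℂ (fun y => ω (q.1, y)) q.2 :=
    DifferentiableAt.comp q.2 (f := fun y => (q.1, y)) (g := ω) h (by fun_prop)
  exact this.hasDerivAt

/-- Applying `X` to a relation `Σ Aₖ·fₖ(ω) = 0` yields `Σ X(Aₖ)·fₖ(ω) = 0`. -/
theorem eventually_sum_polyX_eq_zero {ι : Type*} [Fintype ι] {X₁ X₂ : MvPolynomial (Fin 2) ℂ}
    {ω : ℂ × ℂ → ℂ} {p : ℂ × ℂ} (hω : AnalyticAt ℂ ω p)
    (hX : ∀ᶠ q in 𝓝 p, Xop X₁ X₂ ω q = 0)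
    {A : ι → MvPolynomial (Fin 2) ℂ} {f : ι → ℂ → ℂ} (hf : ∀ k, AnalyticAt ℂ (f k) (ω p))
    (h : ∀ᶠ q in 𝓝 p, ∑ k, pev (A k) q * f k (ω q) = 0) :
    ∀ᶠ q in 𝓝 p, ∑ k, pev (polyX X₁ X₂ (A k)) q * f k (ω q) = 0 := by
  have hf' : ∀ᶠ q in 𝓝 p, ∀ k, AnalyticAt ℂ (f k) (ω q) :=
    hω.continuousAt.eventually (eventually_all.2 fun k => (hf k).eventually_analyticAt)
  filter_upwards [hω.eventually_analyticAt, hX, hf', h.eventually_nhds] with q hωq hXq hfq hq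
  have hω' := hωq.differentiableAt
  have e1 : ∑ k, (pev (pderiv 0 (A k)) q * f k (ω q) +
      pev (A k) q * (deriv (f k) (ω q) * d1 ω q)) = 0 := by
    have H : HasDerivAt (fun x => ∑ k, pev (A k) (x, q.2) * f k (ω (x, q.2)))
        (∑ k, (pev (pderiv 0 (A k)) q * f k (ω q) +
          pev (A k) q * (deriv (f k) (ω q) * d1 ω q))) q.1 :=
      HasDerivAt.fun_sum fun k _ => (hasDerivAt_pev_fst (A k) q.1 q.2).mul
        (HasDerivAt.comp q.1 (h₂ := f k) (h := fun x => ω (x, q.2))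
          (hfq k).differentiableAt.hasDerivAt (hasDerivAt_slice_fst hω'))
    have ht : Tendsto (fun x => (x, q.2)) (𝓝 q.1) (𝓝 q) :=
      Continuous.tendsto (f := fun x : ℂ => (x, q.2)) (by fun_prop) q.1
    exact H.unique ((hasDerivAt_const q.1 (0 : ℂ)).congr_of_eventuallyEq (ht.eventually hq))
  have e2 : ∑ k, (pev (pderiv 1 (A k)) q * f k (ω q) +
      pev (A k) q * (deriv (f k) (ω q) * d2 ω q)) = 0 := by
    have H : HasDerivAt (fun y => ∑ k, pev (A k) (q.1, y) * f k (ω (q.1, y)))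
        (∑ k, (pev (pderiv 1 (A k)) q * f k (ω q) +
          pev (A k) q * (deriv (f k) (ω q) * d2 ω q))) q.2 :=
      HasDerivAt.fun_sum fun k _ => (hasDerivAt_pev_snd (A k) q.1 q.2).mul
        (HasDerivAt.comp q.2 (h₂ := f k) (h := fun y => ω (q.1, y))
          (hfq k).differentiableAt.hasDerivAt (hasDerivAt_slice_snd hω'))
    have ht : Tendsto (fun y => (q.1, y)) (𝓝 q.2) (𝓝 q) :=
      Continuous.tendsto (f := fun y : ℂ => (q.1, y)) (by fun_prop) q.2
    exact H.unique ((hasDerivAt_const q.2 (0 : ℂ)).congr_of_eventuallyEq (ht.eventually hq))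
  calc ∑ k, pev (polyX X₁ X₂ (A k)) q * f k (ω q)
      = pev X₁ q * ∑ k, (pev (pderiv 0 (A k)) q * f k (ω q) +
          pev (A k) q * (deriv (f k) (ω q) * d1 ω q)) +
        pev X₂ q * ∑ k, (pev (pderiv 1 (A k)) q * f k (ω q) +
          pev (A k) q * (deriv (f k) (ω q) * d2 ω q)) -
        ∑ k, pev (A k) q * deriv (f k) (ω q) * Xop X₁ X₂ ω q := by
        simp only [Finset.mul_sum]
        rw [← Finset.sum_add_distrib, ← Finset.sum_sub_distrib]
        refine Finset.sum_congr rfl fun k _ => ?_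
        simp only [polyX, Xop, pev, map_add, map_mul]
        ring
    _ = 0 := by simp [e1, e2, hXq]

theorem map_nhds_slice_snd {ω : ℂ × ℂ → ℂ} {p : ℂ × ℂ} (hω : AnalyticAt ℂ ω p)
    (hω2 : d2 ω p ≠ 0) : map (fun y => ω (p.1, y)) (𝓝 p.2) = 𝓝 (ω p) := by
  have h : AnalyticAt ℂ (fun y => ω (p.1, y)) p.2 :=
    AnalyticAt.fun_comp (g := ω) (f := fun y => (p.1, y)) hω (by fun_prop)
  exact h.hasStrictDerivAt.map_nhds_eq hω2

/-- If `A ≠ 0` and `c(ω)·A` vanishes near `p`, then `c` vanishes near `ω p`. -/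
theorem eventually_eq_zero_of_comp_mul_pev {ω : ℂ × ℂ → ℂ} {p : ℂ × ℂ}
    (hω : AnalyticAt ℂ ω p) (hω2 : d2 ω p ≠ 0) {c : ℂ → ℂ} (hc : AnalyticAt ℂ c (ω p))
    {A : MvPolynomial (Fin 2) ℂ} (hA : A ≠ 0)
    (h : ∀ᶠ q in 𝓝 p, c (ω q) * pev A q = 0) : ∀ᶠ y in 𝓝 (ω p), c y = 0 := by
  have hcont : ∀ᶠ q in 𝓝 p, ContinuousAt (fun q => c (ω q)) q := by
    filter_upwards [hω.eventually_analyticAt,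
      hω.continuousAt.eventually hc.eventually_analyticAt] with q h1 h2
    exact ContinuousAt.comp (g := c) h2.continuousAt h1.continuousAt
  have key : ∀ᶠ q in 𝓝 p, c (ω q) = 0 := by
    filter_upwards [hcont, h.eventually_nhds] with q hq hz
    by_contra hne
    refine hA (eq_zero_of_eventually_pev_eq_zero A q ?_)
    filter_upwards [hq.eventually_ne hne, hz] with r h1 h2
    exact (mul_eq_zero.1 h2).resolve_left h1
  rw [← map_nhds_slice_snd hω hω2, eventually_map]
  have ht : Tendsto (fun y => (p.1, y)) (𝓝 p.2) (𝓝 p) :=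
    Continuous.tendsto (f := fun y : ℂ => (p.1, y)) (by fun_prop) p.2
  exact ht.eventually key

theorem polyX_sum_C_mul {ι : Type*} [Fintype ι] (X₁ X₂ : MvPolynomial (Fin 2) ℂ) (c : ι → ℂ)
    (A : ι → MvPolynomial (Fin 2) ℂ) :
    polyX X₁ X₂ (∑ k, C (c k) * A k) = ∑ k, C (c k) * polyX X₁ X₂ (A k) := by
  simp only [polyX, map_sum, pderiv_C_mul, Finset.mul_sum, ← Finset.sum_add_distrib]
  refine Finset.sum_congr rfl fun k _ => ?_
  ring

/-- If the only rational constants of `X` are the complex numbers, polynomials that satisfy a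
linear relation with coefficients `fₖ(ω)` satisfy it with coefficients `fₖ(y)`. -/
theorem eventually_sum_C_mul_eq_zero {X₁ X₂ : MvPolynomial (Fin 2) ℂ} {ω : ℂ × ℂ → ℂ}
    {p : ℂ × ℂ} (hω : AnalyticAt ℂ ω p) (hX : ∀ᶠ q in 𝓝 p, Xop X₁ X₂ ω q = 0)
    (hω2 : d2 ω p ≠ 0)
    (hconst : ∀ W₁ W₂ : MvPolynomial (Fin 2) ℂ, W₂ ≠ 0 →
      polyX X₁ X₂ W₁ * W₂ - W₁ * polyX X₁ X₂ W₂ = 0 → ∃ c : ℂ, W₁ = C c * W₂)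
    {n : ℕ} (A : Fin n → MvPolynomial (Fin 2) ℂ) (f : Fin n → ℂ → ℂ)
    (hf : ∀ k, AnalyticAt ℂ (f k) (ω p))
    (h : ∀ᶠ q in 𝓝 p, ∑ k, pev (A k) q * f k (ω q) = 0) :
    ∀ᶠ y in 𝓝 (ω p), ∑ k, C (f k y) * A k = 0 := by
  induction n with
  | zero => simp
  | succ n ih =>
    by_cases hA : A (Fin.last n) = 0
    · have := ih (fun k => A k.castSucc) (fun k => f k.castSucc) (fun k => hf _)
        (by simpa [Fin.sum_univ_castSucc, hA, pev] using h)
      simpa [Fin.sum_univ_castSucc, hA] using this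
    set L := A (Fin.last n)
    let D : Fin (n + 1) → MvPolynomial (Fin 2) ℂ :=
      fun k => polyX X₁ X₂ (A k) * L - A k * polyX X₁ X₂ L
    have hDlast : D (Fin.last n) = 0 := by simp only [D, L]; ring
    have hD : ∀ᶠ q in 𝓝 p, ∑ k, pev (D k) q * f k (ω q) = 0 := by
      filter_upwards [h, eventually_sum_polyX_eq_zero hω hX hf h] with q h1 h2
      have : ∑ k, pev (D k) q * f k (ω q) =
          pev L q * ∑ k, pev (polyX X₁ X₂ (A k)) q * f k (ω q) -
          pev (polyX X₁ X₂ L) q * ∑ k, pev (A k) q * f k (ω q) := by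
        simp only [Finset.mul_sum]
        rw [← Finset.sum_sub_distrib]
        refine Finset.sum_congr rfl fun k _ => ?_
        simp only [D, pev, map_sub, map_mul]
        ring
      rw [this, h1, h2]; ring
    have hDy := ih (fun k => D k.castSucc) (fun k => f k.castSucc) (fun k => hf _)
      (by simpa [Fin.sum_univ_castSucc, hDlast, pev] using hD)
    have hprop : ∀ᶠ y in 𝓝 (ω p), ∃ c : ℂ, ∑ k, C (f k y) * A k = C c * L := by
      filter_upwards [hDy] with y hy
      refine hconst _ L hA ?_
      have : ∑ k, C (f k y) * D k = 0 := by
        rw [Fin.sum_univ_castSucc, hDlast, hy]; ring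
      rw [← this, polyX_sum_C_mul, Finset.sum_mul, Finset.sum_mul, ← Finset.sum_sub_distrib]
      refine Finset.sum_congr rfl fun k _ => ?_
      simp only [D]
      ring
    obtain ⟨r, hr⟩ : ∃ r, pev L r ≠ 0 := by
      by_contra! hr
      exact hA (eq_zero_of_eventually_pev_eq_zero L p (Eventually.of_forall hr))
    let c : ℂ → ℂ := fun y => (∑ k, f k y * pev (A k) r) / pev L r
    have hc : AnalyticAt ℂ c (ω p) := by
      refine AnalyticAt.fun_div ?_ analyticAt_const hr
      exact Finset.analyticAt_fun_sum _ fun k _ => (hf k).mul analyticAt_const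
    have hcy : ∀ᶠ y in 𝓝 (ω p), ∑ k, C (f k y) * A k = C (c y) * L := by
      filter_upwards [hprop] with y hy
      obtain ⟨b, hb⟩ := hy
      have hbc : c y = b := by
        have := congrArg (fun W => pev W r) hb
        simp only [pev, map_sum, map_mul, eval_C] at this hr
        simp only [c, pev]
        rw [this, mul_div_assoc, div_self hr, mul_one]
      rw [hb, hbc]
    have hc0 : ∀ᶠ y in 𝓝 (ω p), c y = 0 := by
      refine eventually_eq_zero_of_comp_mul_pev hω hω2 hc hA ?_
      filter_upwards [hω.continuousAt.eventually hcy, h] with q h1 h2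
      have := congrArg (fun W => pev W q) h1
      simp only [pev, map_sum, map_mul, eval_C] at this h2 ⊢
      rw [← this, ← h2]
      exact Finset.sum_congr rfl fun k _ => mul_comm _ _
    filter_upwards [hcy, hc0] with y h1 h2
    rw [h1, h2]; simp

theorem sum_div_mul_eq_sum_erase {ι : Type*} [Fintype ι] [DecidableEq ι]
    (P Q : ι → MvPolynomial (Fin 2) ℂ) {q : ℂ × ℂ} (hQ : ∀ k, pev (Q k) q ≠ 0) (g : ι → ℂ) :
    (∏ j, pev (Q j) q) * ∑ k, pev (P k) q / pev (Q k) q * g k =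
      ∑ k, pev (P k * ∏ j ∈ Finset.univ.erase k, Q j) q * g k := by
  rw [Finset.mul_sum]
  refine Finset.sum_congr rfl fun k _ => ?_
  rw [← Finset.mul_prod_erase _ _ (Finset.mem_univ k)]
  have := hQ k
  simp only [pev, map_mul, map_prod] at this ⊢
  field_simp

/-- a nontrivial relation `Σ αₖ·fₖ(ω) = 0` with rational coefficients which is
not an identity in `(x₁,x₂,y)` forces the existence of a nonconstant rational first
integral `w = W₁/W₂` of `X` (as rational functions). -/
theorem stmt_8 (X₁ X₂ : MvPolynomial (Fin 2) ℂ)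
    (hX₁ : pev X₁ ((0 : ℂ), (0 : ℂ)) ≠ 0) (ω : ℂ × ℂ → ℂ)
    (hω : IsFirstIntegralAt X₁ X₂ ω ((0 : ℂ), (0 : ℂ)))
    (hω0 : ω ((0 : ℂ), (0 : ℂ)) = 0) (hω2 : d2 ω ((0 : ℂ), (0 : ℂ)) ≠ 0)
    (n : ℕ) (P Q : Fin n → MvPolynomial (Fin 2) ℂ)
    (hQ : ∀ k, pev (Q k) ((0 : ℂ), (0 : ℂ)) ≠ 0)
    (f : Fin n → ℂ → ℂ) (hf : ∀ k, AnalyticAt ℂ (f k) 0)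
    (hnz : ¬ ∀ᶠ v in nhds (((0 : ℂ), (0 : ℂ)), (0 : ℂ)),
      ∑ k, (pev (P k) v.1 / pev (Q k) v.1) * f k v.2 = 0)
    (hzero : ∀ᶠ q in nhds ((0 : ℂ), (0 : ℂ)),
      ∑ k, (pev (P k) q / pev (Q k) q) * f k (ω q) = 0) :
    ∃ W₁ W₂ : MvPolynomial (Fin 2) ℂ, W₂ ≠ 0 ∧
      (¬ ∃ c : ℂ, W₁ = MvPolynomial.C c * W₂) ∧
      X₁ * (pderiv (0 : Fin 2) W₁ * W₂ - W₁ * pderiv (0 : Fin 2) W₂) +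
        X₂ * (pderiv (1 : Fin 2) W₁ * W₂ - W₁ * pderiv (1 : Fin 2) W₂) = 0 := by
  by_contra hcon
  have hconst : ∀ W₁ W₂ : MvPolynomial (Fin 2) ℂ, W₂ ≠ 0 →
      polyX X₁ X₂ W₁ * W₂ - W₁ * polyX X₁ X₂ W₂ = 0 → ∃ c : ℂ, W₁ = C c * W₂ := by
    intro W₁ W₂ hW hz
    by_contra hc
    refine hcon ⟨W₁, W₂, hW, hc, ?_⟩
    rw [← hz]
    simp only [polyX]
    ring
  have hQ' : ∀ᶠ q in 𝓝 ((0 : ℂ), (0 : ℂ)), ∀ k, pev (Q k) q ≠ 0 :=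
    eventually_all.2 fun k => (continuous_pev (Q k)).continuousAt.eventually_ne (hQ k)
  have hA : ∀ᶠ q in 𝓝 ((0 : ℂ), (0 : ℂ)),
      ∑ k, pev (P k * ∏ j ∈ Finset.univ.erase k, Q j) q * f k (ω q) = 0 := by
    filter_upwards [hQ', hzero] with q h1 h2
    rw [← sum_div_mul_eq_sum_erase P Q h1, h2, mul_zero]
  have hy := eventually_sum_C_mul_eq_zero hω.1 hω.2.1 hω2 hconst _ f
    (fun k => by rw [hω0]; exact hf k) hA
  rw [hω0] at hy
  apply hnz
  rw [nhds_prod_eq]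
  filter_upwards [hQ'.prod_mk hy] with v hv
  obtain ⟨h1, h2⟩ := hv
  have h3 := sum_div_mul_eq_sum_erase P Q h1 (fun k => f k v.2)
  refine (mul_eq_zero.1 (h3.trans ?_)).resolve_left (Finset.prod_ne_zero_iff.2 fun k _ => h1 k)
  have h4 := congrArg (fun W => pev W v.1) h2
  simp only [pev, map_sum, map_mul, eval_C, map_zero] at h4 ⊢
  rw [← h4]
  exact Finset.sum_congr rfl fun k _ => mul_comm _ _
end
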